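/- The genus of X_q^1 = X_q/⟨z ↦ z+1⟩ is zero if and only if q ≤ 10 or q = 12 (for q ≥ 5). Equivalently, q - 6·𝒩(q) < 0 exactly for q ∈ {5,6,7,8,9,10,12} among q ≥ 5, where 𝒩 is the multiplicative function with 𝒩(p^r) = 1 + r(p-1)/(p+1). -/

import Mathlib

open Matrix CongruenceSubgroup

local notation "SL2Z" => Matrix.SpecialLinearGroup (Fin 2) ℤ

/-- `±Γ` : the subgroup generated by `Γ` and `-1`. -/
def pm (Γ : Subgroup SL2Z) : Subgroup SL2Z := Γ ⊔ Subgroup.zpowers (-1)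

/-- Matrices in `SL(2, ℤ)` whose upper-right entry is divisible by `n`. -/
def GammaUpper (n : ℕ) : Subgroup SL2Z where
  carrier := { g | ((g 0 1 : ℤ) : ZMod n) = 0 }
  one_mem' := by simp
  mul_mem' := by
    intro a b ha hb
    have h := (Matrix.two_mul_expl a.1 b.1).2.1
    simp only [Set.mem_setOf_eq] at *
    rw [Matrix.SpecialLinearGroup.coe_mul, h]
    push_cast
    rw [ha, hb]
    ring
  inv_mem' := by
    intro a ha
    simp only [Set.mem_setOf_eq] at *
    rw [Matrix.SpecialLinearGroup.SL2_inv_expl a]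
    simp [ha]

/-- The group `Γ_q^n`: `a ≡ d ≡ 1, c ≡ 0 (mod q)` and `b ≡ 0 (mod n)`. -/
def GammaQN (q n : ℕ) : Subgroup SL2Z := Gamma1 q ⊓ GammaUpper n

/-- The Möbius action of `SL(2, ℤ)` on `ℚ ∪ {∞}`, with `∞` encoded as `none`. -/
def moebius (g : Matrix.SpecialLinearGroup (Fin 2) ℤ) (x : Option ℚ) : Option ℚ :=
  match x with
  | none => if ((g.1 1 0 : ℤ) : ℚ) = 0 then none
      else some (((g.1 0 0 : ℤ) : ℚ) / ((g.1 1 0 : ℤ) : ℚ))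
  | some t => if ((g.1 1 0 : ℤ) : ℚ) * t + ((g.1 1 1 : ℤ) : ℚ) = 0 then none
      else some ((((g.1 0 0 : ℤ) : ℚ) * t + ((g.1 0 1 : ℤ) : ℚ)) /
        (((g.1 1 0 : ℤ) : ℚ) * t + ((g.1 1 1 : ℤ) : ℚ)))

/-- Two cusps are `Γ`-equivalent if some element of `Γ` maps one to the other. -/
def cuspRel (G : Subgroup (Matrix.SpecialLinearGroup (Fin 2) ℤ)) (x y : Option ℚ) : Prop :=
  ∃ γ ∈ G, moebius γ x = y

/-- The number of cusps of `Γ`, i.e. the number of `Γ`-orbits on `ℚ ∪ {∞}`. -/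
noncomputable def numCusps (G : Subgroup (Matrix.SpecialLinearGroup (Fin 2) ℤ)) : ℕ :=
  Nat.card (Quot (cuspRel G))

/-- The multiplicative function `𝒩` with `𝒩(p^r) = 1 + r(p-1)/(p+1)` for primes `p`. -/
def calN (m : ℕ) : ℚ :=
  ∏ p ∈ m.primeFactors, (1 + (m.factorization p) * ((p : ℚ) - 1) / ((p : ℚ) + 1))

/-- Euler's totient as an arithmetic function. -/
def totientFun : ArithmeticFunction ℕ := ⟨Nat.totient, Nat.totient_zero⟩

lemma totientFun_apply (n : ℕ) : totientFun n = n.totient := rfl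

lemma isMultiplicative_totientFun : totientFun.IsMultiplicative :=
  ArithmeticFunction.IsMultiplicative.iff_ne_zero.2
    ⟨Nat.totient_one, fun _ _ h => Nat.totient_mul h⟩

/-- The number `∑ φ(d) φ(q / d)` of orbits of `(c, d) ↦ (c, c + d)` on primitive pairs mod `q`. -/
def orbitFun : ArithmeticFunction ℕ := totientFun * totientFun

/-- The number of primitive pairs mod `q`. -/
def pairFun : ArithmeticFunction ℕ := (ArithmeticFunction.id.pmul totientFun) * totientFun

lemma isMultiplicative_orbitFun : orbitFun.IsMultiplicative :=
  isMultiplicative_totientFun.mul isMultiplicative_totientFun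

lemma isMultiplicative_pairFun : pairFun.IsMultiplicative :=
  (ArithmeticFunction.isMultiplicative_id.pmul isMultiplicative_totientFun).mul
    isMultiplicative_totientFun

lemma orbitFun_apply (n : ℕ) :
    orbitFun n = ∑ d ∈ n.divisors, d.totient * (n / d).totient := by
  simp only [orbitFun, ArithmeticFunction.mul_apply, totientFun_apply]
  exact Nat.sum_divisorsAntidiagonal (fun a b => a.totient * b.totient)

lemma pairFun_apply (n : ℕ) :
    pairFun n = ∑ d ∈ n.divisors, d * d.totient * (n / d).totient := by
  simp only [pairFun, ArithmeticFunction.mul_apply, totientFun_apply,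
    ArithmeticFunction.pmul_apply, ArithmeticFunction.id_apply]
  exact Nat.sum_divisorsAntidiagonal (fun a b => a * a.totient * b.totient)

lemma cast_totient_prime_pow_succ {p : ℕ} (hp : p.Prime) (k : ℕ) :
    ((p ^ (k + 1)).totient : ℚ) = (p : ℚ) ^ k * (p - 1) := by
  rw [Nat.totient_prime_pow_succ hp, Nat.cast_mul, Nat.cast_pow, Nat.cast_pred hp.pos]

lemma orbitFun_prime_pow {p : ℕ} (hp : p.Prime) (k : ℕ) :
    (p : ℚ) * orbitFun (p ^ (k + 1)) = (p : ℚ) ^ k * (p - 1) * (2 * p + k * (p - 1)) := by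
  have hmid : ∀ i ∈ Finset.range k,
      (p : ℚ) * (((p ^ (i + 1)).totient : ℚ) * ((p ^ (k + 1) / p ^ (i + 1)).totient : ℚ)) =
        (p : ℚ) ^ k * (p - 1) ^ 2 := by
    intro i hi
    obtain ⟨j, rfl⟩ := Nat.exists_eq_add_of_lt (Finset.mem_range.1 hi)
    rw [Nat.pow_div (by lia) hp.pos, show i + j + 1 + 1 - (i + 1) = j + 1 by lia,
      cast_totient_prime_pow_succ hp, cast_totient_prime_pow_succ hp]
    ring
  rw [orbitFun_apply, Nat.sum_divisors_prime_pow hp, Finset.sum_range_succ, Finset.sum_range_succ']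
  push_cast
  rw [mul_add, mul_add, Finset.mul_sum, Finset.sum_congr rfl hmid,
    Nat.div_self (pow_pos hp.pos _), cast_totient_prime_pow_succ hp]
  simp [cast_totient_prime_pow_succ hp]
  ring

lemma pairFun_prime_pow {p : ℕ} (hp : p.Prime) (k : ℕ) :
    (pairFun (p ^ (k + 1)) : ℚ) = (p : ℚ) ^ (2 * k) * (p - 1) * (p + 1) := by
  have hmid : ∀ i ∈ Finset.range k,
      ((p : ℚ) ^ (i + 1) * ((p ^ (i + 1)).totient : ℚ)) *
          ((p ^ (k + 1) / p ^ (i + 1)).totient : ℚ) =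
        (p : ℚ) ^ k * (p - 1) * (p ^ i * (p - 1)) := by
    intro i hi
    obtain ⟨j, rfl⟩ := Nat.exists_eq_add_of_lt (Finset.mem_range.1 hi)
    rw [Nat.pow_div (by lia) hp.pos, show i + j + 1 + 1 - (i + 1) = j + 1 by lia,
      cast_totient_prime_pow_succ hp, cast_totient_prime_pow_succ hp]
    ring
  rw [pairFun_apply, Nat.sum_divisors_prime_pow hp, Finset.sum_range_succ, Finset.sum_range_succ']
  push_cast
  rw [Finset.sum_congr rfl hmid, ← Finset.mul_sum, ← Finset.sum_mul, geom_sum_mul,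
    Nat.div_self (pow_pos hp.pos _), cast_totient_prime_pow_succ hp]
  simp [cast_totient_prime_pow_succ hp]
  ring

lemma calN_mul {a b : ℕ} (h : a.Coprime b) : calN (a * b) = calN a * calN b := by
  unfold calN
  rw [h.primeFactors_mul, Finset.prod_union h.disjoint_primeFactors]
  congr 1
  · refine Finset.prod_congr rfl fun p hp => ?_
    rw [Nat.factorization_eq_of_coprime_left h (by simpa using hp)]
  · refine Finset.prod_congr rfl fun p hp => ?_
    rw [Nat.factorization_eq_of_coprime_right h (by simpa using hp)]

lemma calN_prime_pow {p : ℕ} (hp : p.Prime) {k : ℕ} (hk : k ≠ 0) :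
    calN (p ^ k) = 1 + k * ((p : ℚ) - 1) / (p + 1) := by
  simp [calN, Nat.primeFactors_prime_pow hk hp, hp.factorization_self]

lemma mul_orbitFun_eq (q : ℕ) : (q : ℚ) * orbitFun q = calN q * pairFun q := by
  induction q using Nat.recOnPosPrimePosCoprime with
  | zero => simp
  | one => simp [isMultiplicative_orbitFun.1, isMultiplicative_pairFun.1, calN]
  | prime_pow p n hp hn =>
    obtain ⟨k, rfl⟩ := Nat.exists_eq_succ_of_ne_zero hn.ne'
    have h1 : (p : ℚ) + 1 ≠ 0 := by positivity
    rw [Nat.succ_eq_add_one, calN_prime_pow hp (by lia), pairFun_prime_pow hp, Nat.cast_pow,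
      pow_succ, mul_assoc, orbitFun_prime_pow hp]
    push_cast
    field_simp
    ring
  | coprime a b _ _ hab iha ihb =>
    rw [isMultiplicative_orbitFun.map_mul_of_coprime hab,
      isMultiplicative_pairFun.map_mul_of_coprime hab, calN_mul hab]
    push_cast
    linear_combination (b * orbitFun b : ℚ) * iha + calN a * pairFun a * ihb

/-- The local factor of `calN m / m` at a prime `p` dividing `m` exactly `k` times. -/
def localRatio (p k : ℕ) : ℚ := (1 + k * ((p : ℚ) - 1) / (p + 1)) / (p : ℚ) ^ k

lemma localRatio_nonneg {p : ℕ} (hp : p.Prime) (k : ℕ) : 0 ≤ localRatio p k := by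
  have : (1 : ℚ) ≤ p := mod_cast hp.one_le
  have : 0 ≤ (p : ℚ) - 1 := by linarith
  unfold localRatio
  positivity

lemma antitone_localRatio {p : ℕ} (hp : p.Prime) : Antitone (localRatio p) := by
  refine antitone_nat_of_succ_le fun k => ?_
  have h2 : (2 : ℚ) ≤ p := mod_cast hp.two_le
  have h0 : (0 : ℚ) < (p : ℚ) ^ k := by positivity
  unfold localRatio
  rw [div_le_div_iff₀ (by positivity) h0, pow_succ, mul_comm _ ((p : ℚ) ^ k), mul_left_comm]
  refine mul_le_mul_of_nonneg_left ?_ h0.le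
  have hx0 : 0 ≤ ((p : ℚ) - 1) / (p + 1) := div_nonneg (by linarith) (by linarith)
  have hx1 : ((p : ℚ) - 1) / (p + 1) ≤ 1 := (div_le_one (by linarith)).2 (by linarith)
  push_cast
  rw [mul_div_assoc, mul_div_assoc]
  generalize ((p : ℚ) - 1) / (p + 1) = x at *
  have hk : 0 ≤ (k : ℚ) * x := by positivity
  nlinarith

lemma calN_div_eq_prod {m n : ℕ} (hm : m ≠ 0) (hn : n ≠ 0) (h : m ∣ n) :
    calN m / m = ∏ p ∈ n.primeFactors, localRatio p (m.factorization p) := by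
  rw [← Finset.prod_subset (Nat.primeFactors_mono h hn) fun p _ hp => by
    rw [Finsupp.notMem_support_iff.1 (by simpa using hp)]; simp [localRatio]]
  unfold localRatio calN
  rw [Finset.prod_div_distrib]
  congr 1
  conv_lhs => rw [← Nat.prod_factorization_pow_eq_self hm]
  simp [Finsupp.prod]

lemma calN_div_antitone {m n : ℕ} (hn : n ≠ 0) (h : m ∣ n) : calN n / n ≤ calN m / m := by
  have hm : m ≠ 0 := ne_zero_of_dvd_ne_zero hn h
  rw [calN_div_eq_prod hm hn h, calN_div_eq_prod hn hn dvd_rfl]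
  refine Finset.prod_le_prod (fun p hp => localRatio_nonneg (Nat.prime_of_mem_primeFactors hp) _)
    fun p hp => antitone_localRatio (Nat.prime_of_mem_primeFactors hp) ?_
  exact (Nat.factorization_le_iff_dvd hm hn).2 h p

/-- Minimal composite numbers, for divisibility, for which `X₁` has positive genus. -/
def minimalLevels : Finset ℕ := {14, 15, 16, 18, 20, 21, 24, 25, 27, 35, 49}

/-- The levels for which `X₁` has genus zero. -/
def genusZeroLevels : Finset ℕ := {1, 2, 3, 4, 5, 6, 7, 8, 9, 10, 12}

lemma exists_dvd_of_notMem_genusZeroLevels {q : ℕ} (h0 : q ≠ 0) (hq : q ∉ genusZeroLevels) :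
    ∃ d, d ∣ q ∧ (d ∈ minimalLevels ∨ d.Prime ∧ 11 ≤ d) := by
  induction q using induction_on_primes with
  | zero => exact absurd rfl h0
  | one => exact absurd (by decide) hq
  | prime_mul p m hp ih =>
    have hm0 : m ≠ 0 := right_ne_zero_of_mul h0
    by_cases hm : m ∈ genusZeroLevels
    · by_cases hp11 : 11 ≤ p
      · exact ⟨p, dvd_mul_right p m, .inr ⟨hp, hp11⟩⟩
      · have key : ∀ p < 11, p.Prime → ∀ m ∈ genusZeroLevels, p * m ∉ genusZeroLevels →
            ∃ d ∈ minimalLevels, d ∣ p * m := by decide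
        obtain ⟨d, hd, hdvd⟩ := key p (by lia) hp m hm hq
        exact ⟨d, hdvd, .inl hd⟩
    · obtain ⟨d, hd, h⟩ := ih hm0 hm
      exact ⟨d, hd.mul_left p, h⟩

lemma calN_prime_pow_mul_prime_pow {p r j k : ℕ} (hp : p.Prime) (hr : r.Prime) (h : p ≠ r)
    (hj : j ≠ 0) (hk : k ≠ 0) :
    calN (p ^ j * r ^ k) =
      (1 + j * ((p : ℚ) - 1) / (p + 1)) * (1 + k * ((r : ℚ) - 1) / (r + 1)) := by
  rw [calN_mul (Nat.Coprime.pow _ _ ((Nat.coprime_primes hp hr).2 h)), calN_prime_pow hp hj,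
    calN_prime_pow hr hk]

lemma six_mul_calN_le_of_mem_minimalLevels {d : ℕ} (hd : d ∈ minimalLevels) :
    6 * calN d ≤ d := by
  have h2 := Nat.prime_two
  have h3 := Nat.prime_three
  have h5 := Nat.prime_five
  have h7 : Nat.Prime 7 := by norm_num
  simp only [minimalLevels, Finset.mem_insert, Finset.mem_singleton] at hd
  rcases hd with rfl | rfl | rfl | rfl | rfl | rfl | rfl | rfl | rfl | rfl | rfl
  · have := calN_prime_pow_mul_prime_pow (j := 1) (k := 1) h2 h7 (by simp) (by simp) (by simp)
    norm_num at this ⊢; linarith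
  · have := calN_prime_pow_mul_prime_pow (j := 1) (k := 1) h3 h5 (by simp) (by simp) (by simp)
    norm_num at this ⊢; linarith
  · have := calN_prime_pow (k := 4) h2 (by simp)
    norm_num at this ⊢; linarith
  · have := calN_prime_pow_mul_prime_pow (j := 1) (k := 2) h2 h3 (by simp) (by simp) (by simp)
    norm_num at this ⊢; linarith
  · have := calN_prime_pow_mul_prime_pow (j := 2) (k := 1) h2 h5 (by simp) (by simp) (by simp)
    norm_num at this ⊢; linarith
  · have := calN_prime_pow_mul_prime_pow (j := 1) (k := 1) h3 h7 (by simp) (by simp) (by simp)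
    norm_num at this ⊢; linarith
  · have := calN_prime_pow_mul_prime_pow (j := 3) (k := 1) h2 h3 (by simp) (by simp) (by simp)
    norm_num at this ⊢; linarith
  · have := calN_prime_pow (k := 2) h5 (by simp)
    norm_num at this ⊢; linarith
  · have := calN_prime_pow (k := 3) h3 (by simp)
    norm_num at this ⊢; linarith
  · have := calN_prime_pow_mul_prime_pow (j := 1) (k := 1) h5 h7 (by simp) (by simp) (by simp)
    norm_num at this ⊢; linarith
  · have := calN_prime_pow (k := 2) h7 (by simp)
    norm_num at this ⊢; linarith

lemma six_mul_calN_le_of_prime {p : ℕ} (hp : p.Prime) (h : 11 ≤ p) : 6 * calN p ≤ p := by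
  have h1 := calN_prime_pow hp one_ne_zero
  have h' : (11 : ℚ) ≤ p := mod_cast h
  rw [pow_one] at h1
  rw [h1, Nat.cast_one, one_mul, ← sub_nonneg]
  have : (p : ℚ) - 6 * (1 + (p - 1) / (p + 1)) = p * (p - 11) / (p + 1) := by
    field_simp
    ring
  rw [this]
  exact div_nonneg (mul_nonneg (by linarith) (by linarith)) (by linarith)

lemma six_mul_calN_le {q : ℕ} (h0 : q ≠ 0) (hq : q ∉ genusZeroLevels) : 6 * calN q ≤ q := by
  obtain ⟨d, hdq, hd⟩ := exists_dvd_of_notMem_genusZeroLevels h0 hq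
  have hd6 : 6 * calN d ≤ d := by
    rcases hd with hd | ⟨hp, h11⟩
    · exact six_mul_calN_le_of_mem_minimalLevels hd
    · exact six_mul_calN_le_of_prime hp h11
  have hd0 : (0 : ℚ) < d := by
    exact_mod_cast Nat.pos_of_ne_zero (ne_zero_of_dvd_ne_zero h0 hdq)
  have hq0 : (0 : ℚ) < q := by exact_mod_cast Nat.pos_of_ne_zero h0
  have h1 : calN d / d ≤ 1 / 6 := by rw [div_le_div_iff₀ hd0 (by norm_num)]; linarith
  have h2 := (calN_div_antitone h0 hdq).trans h1
  rw [div_le_div_iff₀ hq0 (by norm_num)] at h2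
  linarith

lemma pairFun_pos {q : ℕ} (h : q ≠ 0) : 0 < pairFun q := by
  rw [pairFun_apply]
  refine Finset.sum_pos (fun d hd => ?_) (Nat.nonempty_divisors.2 h)
  have hd0 := Nat.pos_of_mem_divisors hd
  have := Nat.div_pos (Nat.divisor_le hd) hd0
  simp [*]

lemma orbitFun_eq_of_mem {q : ℕ} (hq : q ≤ 10 ∨ q = 12) (h5 : 5 ≤ q) :
    24 + pairFun q = 6 * orbitFun q := by
  have key : ∀ q ∈ ({5, 6, 7, 8, 9, 10, 12} : Finset ℕ),
      24 + ∑ d ∈ q.divisors, d * d.totient * (q / d).totient =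
        6 * ∑ d ∈ q.divisors, d.totient * (q / d).totient := by decide
  rw [pairFun_apply, orbitFun_apply]
  exact key q (by simp; lia)

lemma sub_six_mul_calN_neg_iff {q : ℕ} (h5 : 5 ≤ q) :
    (q : ℚ) - 6 * calN q < 0 ↔ (q ≤ 10 ∨ q = 12) := by
  refine ⟨fun h => ?_, fun h => ?_⟩
  · by_contra hq
    have := six_mul_calN_le (q := q) (by lia) (by simp [genusZeroLevels]; lia)
    linarith
  · have h1 := mul_orbitFun_eq q
    have h2 : (24 : ℚ) + pairFun q = 6 * orbitFun q := mod_cast orbitFun_eq_of_mem h h5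
    have h3 : (0 : ℚ) < pairFun q := mod_cast pairFun_pos (q := q) (by lia)
    have h4 : (5 : ℚ) ≤ q := mod_cast h5
    by_contra! h6
    nlinarith

lemma orbitFun_eq_iff {q : ℕ} (h5 : 5 ≤ q) :
    (24 + pairFun q : ℚ) = 6 * orbitFun q ↔ (q ≤ 10 ∨ q = 12) := by
  refine ⟨fun h => ?_, fun h => by exact_mod_cast orbitFun_eq_of_mem h h5⟩
  rw [← sub_six_mul_calN_neg_iff h5]
  have h1 := mul_orbitFun_eq q
  have h3 : (0 : ℚ) < pairFun q := mod_cast pairFun_pos (q := q) (by lia)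
  have h4 : (5 : ℚ) ≤ q := mod_cast h5
  by_contra! h6
  nlinarith

section PrimitivePairs

variable {q : ℕ}

/-- Primitive pairs modulo `q`. -/
abbrev PrimPair (q : ℕ) : Type := {v : ZMod q × ZMod q // IsCoprime v.1 v.2}

lemma cast_gcd_val_eq_mul [NeZero q] (c : ZMod q) :
    ((q.gcd c.val : ℕ) : ZMod q) = c * ((Nat.gcdB q c.val : ℤ) : ZMod q) := by
  have h := congrArg (Int.cast : ℤ → ZMod q) (Nat.gcd_eq_gcd_ab q c.val)
  push_cast at h
  simpa using h

lemma isCoprime_iff_coprime_gcd_val [NeZero q] (c d : ZMod q) :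
    IsCoprime c d ↔ (q.gcd c.val).Coprime d.val := by
  constructor
  · rintro ⟨x, y, hxy⟩
    have h1 : ((x.val * c.val + y.val * d.val : ℕ) : ZMod q) = (1 : ℕ) := by simpa using hxy
    rw [ZMod.natCast_eq_natCast_iff] at h1
    set g := (q.gcd c.val).gcd d.val
    have hgq : g ∣ q := (Nat.gcd_dvd_left _ _).trans (Nat.gcd_dvd_left _ _)
    have hgc : g ∣ c.val := (Nat.gcd_dvd_left _ _).trans (Nat.gcd_dvd_right _ _)
    have hgd : g ∣ d.val := Nat.gcd_dvd_right _ _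
    exact Nat.dvd_one.1
      (((h1.of_dvd hgq).dvd_iff dvd_rfl).1 ((hgc.mul_left _).add (hgd.mul_left _)))
  · intro h
    obtain ⟨x, y, hxy⟩ := Nat.isCoprime_iff_coprime.2 h
    refine ⟨x * (Nat.gcdB q c.val : ℤ), y, ?_⟩
    have h1 := congrArg (Int.cast : ℤ → ZMod q) hxy
    push_cast at h1
    rw [cast_gcd_val_eq_mul] at h1
    rw [← h1, ZMod.natCast_zmod_val]
    ring

lemma card_range_mul_filter_coprime (e k : ℕ) :
    ((Finset.range (e * k)).filter e.Coprime).card = k * e.totient := by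
  induction k with
  | zero => simp
  | succ k ih =>
    have hd : Disjoint ((Finset.Ico 0 (e * k)).filter e.Coprime)
        ((Finset.Ico (e * k) (e * k + e)).filter e.Coprime) :=
      (Finset.Ico_disjoint_Ico_consecutive 0 (e * k) _).mono
        (Finset.filter_subset _ _) (Finset.filter_subset _ _)
    rw [add_one_mul, ← ih, ← Nat.filter_coprime_Ico_eq_totient e (e * k), mul_add_one,
      Finset.range_eq_Ico,
      ← Finset.Ico_union_Ico_eq_Ico (Nat.zero_le (e * k)) (Nat.le_add_right _ e),
      Finset.filter_union, Finset.card_union_of_disjoint hd, Finset.range_eq_Ico]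

lemma sum_zmod_val {M : Type*} [AddCommMonoid M] [NeZero q] (f : ℕ → M) :
    ∑ x : ZMod q, f x.val = ∑ i ∈ Finset.range q, f i := by
  refine Finset.sum_nbij' ZMod.val (fun i => (i : ZMod q)) ?_ ?_ ?_ ?_ ?_
  · exact fun x _ => Finset.mem_range.2 x.val_lt
  · simp
  · simp
  · exact fun i hi => ZMod.val_cast_of_lt (Finset.mem_range.1 hi)
  · simp

lemma sum_zmod_gcd [NeZero q] (f : ℕ → ℕ) :
    ∑ c : ZMod q, f (q.gcd c.val) = ∑ e ∈ q.divisors, (q / e).totient * f e := by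
  rw [sum_zmod_val (fun i => f (q.gcd i)), ← Finset.sum_fiberwise_of_maps_to
    (fun i _ => Nat.mem_divisors.2 ⟨Nat.gcd_dvd_left q i, NeZero.ne q⟩)]
  refine Finset.sum_congr rfl fun e he => ?_
  rw [Nat.totient_div_of_dvd (Nat.dvd_of_mem_divisors he), ← smul_eq_mul, ← Finset.sum_const]
  exact Finset.sum_congr rfl fun i hi => by rw [(Finset.mem_filter.1 hi).2]

open Classical in
lemma card_isCoprime [NeZero q] (c : ZMod q) :
    Fintype.card {d : ZMod q // IsCoprime c d} =
      q / q.gcd c.val * (q.gcd c.val).totient := by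
  rw [← card_range_mul_filter_coprime, Nat.mul_div_cancel' (Nat.gcd_dvd_left _ _),
    Fintype.card_subtype, Finset.card_filter, Finset.card_filter, ← sum_zmod_val]
  simp only [isCoprime_iff_coprime_gcd_val]

open Classical in
lemma sum_primPair [NeZero q] (f : ℕ → ℕ) :
    ∑ v : PrimPair q, f (q.gcd v.1.1.val) =
      ∑ e ∈ q.divisors, (q / e).totient * (q / e * e.totient * f e) := by
  rw [← sum_zmod_gcd (fun e => q / e * e.totient * f e)]
  refine (Fintype.sum_equiv (Equiv.subtypeProdEquivSigmaSubtype
    fun c d : ZMod q => IsCoprime c d) _ (fun v => f (q.gcd v.1.val)) (fun _ => rfl)).trans ?_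
  rw [Fintype.sum_sigma]
  simp [card_isCoprime]

lemma card_primPair [NeZero q] : Nat.card (PrimPair q) = pairFun q := by
  classical
  have h := sum_primPair (q := q) fun _ => 1
  simp only [Finset.sum_const, Finset.card_univ, smul_eq_mul, mul_one] at h
  rw [Nat.card_eq_fintype_card, h, pairFun_apply, ← Nat.sum_div_divisors]
  refine Finset.sum_congr rfl fun e he => ?_
  rw [Nat.div_div_self (Nat.dvd_of_mem_divisors he) (NeZero.ne q)]
  ring

open Classical in
lemma sum_gcd_primPair [NeZero q] :
    ∑ v : PrimPair q, q.gcd v.1.1.val = q * orbitFun q := by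
  rw [sum_primPair fun e => e, orbitFun_apply, Finset.mul_sum]
  refine Finset.sum_congr rfl fun e he => ?_
  have h := Nat.div_mul_cancel (Nat.dvd_of_mem_divisors he)
  calc _ = (q / e * e) * (e.totient * (q / e).totient) := by ring
    _ = _ := by rw [h]

lemma card_mul_eq_zero [NeZero q] (c : ZMod q) :
    Nat.card {j : ZMod q // j * c = 0} = q.gcd c.val := by
  have h := IsAddCyclic.card_nsmulAddMonoidHom_ker (G := ZMod q) c.val
  rw [Nat.card_zmod] at h
  rw [← h]
  refine Nat.card_congr (Equiv.subtypeEquivRight fun j => ?_)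
  simp [AddMonoidHom.mem_ker, mul_comm]

/-- The group of signs and shears acting on primitive pairs modulo `q`. -/
abbrev ShearGroup (q : ℕ) : Type := ℤˣ × Multiplicative (ZMod q)

lemma intUnits_cast_mul_self (u : ℤˣ) : ((u : ℤ) : ZMod q) * ((u : ℤ) : ZMod q) = 1 := by
  rw [← Int.cast_mul, ← Units.val_mul, Int.units_mul_self]
  simp

/-- `(ε, j)` acts by `(c, d) ↦ ε (c, d + j c)`. -/
instance : MulAction (ShearGroup q) (PrimPair q) where
  smul g v := ⟨(((g.1 : ℤ) : ZMod q) * v.1.1,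
      ((g.1 : ℤ) : ZMod q) * (v.1.2 + g.2.toAdd * v.1.1)), by
    obtain ⟨⟨c, d⟩, x, y, h⟩ := v
    have hu := intUnits_cast_mul_self (q := q) g.1
    exact ⟨(x - y * g.2.toAdd) * ((g.1 : ℤ) : ZMod q), y * ((g.1 : ℤ) : ZMod q), by
      linear_combination h + (x * c + y * d) * hu⟩⟩
  one_smul v := Subtype.ext <| Prod.ext
    (show ((((1 : ℤˣ) : ℤ)) : ZMod q) * v.1.1 = v.1.1 by simp)
    (show ((((1 : ℤˣ) : ℤ)) : ZMod q) * (v.1.2 + 0 * v.1.1) = v.1.2 by simp)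
  mul_smul g h v := Subtype.ext <| Prod.ext
    (show (((g.1 * h.1 : ℤˣ) : ℤ) : ZMod q) * v.1.1 =
      ((g.1 : ℤ) : ZMod q) * (((h.1 : ℤ) : ZMod q) * v.1.1) by push_cast; ring)
    (show (((g.1 * h.1 : ℤˣ) : ℤ) : ZMod q) *
        (v.1.2 + (g.2.toAdd + h.2.toAdd) * v.1.1) =
      ((g.1 : ℤ) : ZMod q) * (((h.1 : ℤ) : ZMod q) * (v.1.2 + h.2.toAdd * v.1.1) +
        g.2.toAdd * (((h.1 : ℤ) : ZMod q) * v.1.1)) by push_cast; ring)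

lemma shear_smul_eq_iff (g : ShearGroup q) (v w : PrimPair q) :
    g • v = w ↔ ((g.1 : ℤ) : ZMod q) * v.1.1 = w.1.1 ∧
      ((g.1 : ℤ) : ZMod q) * (v.1.2 + g.2.toAdd * v.1.1) = w.1.2 :=
  Subtype.ext_iff.trans Prod.ext_iff

lemma zmod_natCast_ne_zero {n : ℕ} (hn : n ≠ 0) (hq : n < q) : (n : ZMod q) ≠ 0 := by
  rw [Ne, ZMod.natCast_eq_zero_iff]
  exact fun h => absurd (Nat.le_of_dvd (Nat.pos_of_ne_zero hn) h) (by lia)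

lemma shear_smul_eq_self_iff (hq : 5 ≤ q) (g : ShearGroup q) (v : PrimPair q) :
    g • v = v ↔ g.1 = 1 ∧ g.2.toAdd * v.1.1 = 0 := by
  obtain ⟨⟨c, d⟩, x, y, h⟩ := v
  obtain ⟨ε, j⟩ := g
  rw [shear_smul_eq_iff]
  rcases Int.units_eq_one_or ε with rfl | rfl
  · simp
  · simp only [Units.val_neg, Units.val_one, Int.cast_neg, Int.cast_one]
    refine ⟨fun ⟨h1, h2⟩ => absurd ?_ (zmod_natCast_ne_zero (q := q) four_ne_zero hq),
      fun h => absurd h.1 (by decide)⟩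
    push_cast
    linear_combination -4 * h + (-2 * x + y * j.toAdd) * h1 - 2 * y * h2

open Classical in
lemma card_smul_eq_self [NeZero q] (hq : 5 ≤ q) (v : PrimPair q) :
    Fintype.card {g : ShearGroup q // g • v = v} = q.gcd v.1.1.val := by
  rw [← card_mul_eq_zero, ← Nat.card_eq_fintype_card]
  refine Nat.card_congr
    { toFun := fun g => ⟨g.1.2.toAdd, ((shear_smul_eq_self_iff hq _ _).1 g.2).2⟩
      invFun := fun j => ⟨(1, .ofAdd j.1), (shear_smul_eq_self_iff hq _ _).2 ⟨rfl, j.2⟩⟩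
      left_inv := fun g => Subtype.ext <|
        Prod.ext ((shear_smul_eq_self_iff hq _ _).1 g.2).1.symm rfl
      right_inv := fun j => rfl }

lemma two_mul_card_orbits [NeZero q] (hq : 5 ≤ q) :
    2 * Nat.card (MulAction.orbitRel.Quotient (ShearGroup q) (PrimPair q)) = orbitFun q := by
  classical
  have h := MulAction.sum_card_fixedBy_eq_card_orbits_mul_card_group (ShearGroup q) (PrimPair q)
  have h2 : ∑ g : ShearGroup q, Fintype.card (MulAction.fixedBy (PrimPair q) g) =
      ∑ v : PrimPair q, q.gcd v.1.1.val := by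
    rw [← Fintype.card_sigma]
    simp_rw [← card_smul_eq_self hq]
    rw [← Fintype.card_sigma]
    exact Fintype.card_congr
      { toFun := fun x => ⟨x.2.1, x.1, x.2.2⟩
        invFun := fun x => ⟨x.2.1, x.1, x.2.2⟩
        left_inv := fun _ => rfl
        right_inv := fun _ => rfl }
  rw [h2, sum_gcd_primPair, Fintype.card_prod, Fintype.card_units_int, Fintype.card_multiplicative,
    ZMod.card, ← Nat.card_eq_fintype_card] at h
  exact Nat.eq_of_mul_eq_mul_left (NeZero.pos q) (by rw [h]; ring)

end PrimitivePairs

section ModularGroup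

variable {q : ℕ}

lemma det_entries (g : SL2Z) : g 0 0 * g 1 1 - g 0 1 * g 1 0 = 1 := by
  rw [← Matrix.det_fin_two, g.det_coe]

lemma det_entries_zmod (q : ℕ) (g : SL2Z) :
    ((g 0 0 : ℤ) : ZMod q) * ((g 1 1 : ℤ) : ZMod q) -
      ((g 0 1 : ℤ) : ZMod q) * ((g 1 0 : ℤ) : ZMod q) = 1 := by
  exact_mod_cast congrArg (Int.cast : ℤ → ZMod q) (det_entries g)

lemma mul_entry (g h : SL2Z) (i j : Fin 2) :
    (g * h) i j = g i 0 * h 0 j + g i 1 * h 1 j := by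
  rw [Matrix.SpecialLinearGroup.coe_mul, Matrix.mul_apply, Fin.sum_univ_two]

lemma inv_entries (g : SL2Z) :
    g⁻¹ 0 0 = g 1 1 ∧ g⁻¹ 0 1 = -g 0 1 ∧ g⁻¹ 1 0 = -g 1 0 ∧ g⁻¹ 1 1 = g 0 0 := by
  rw [Matrix.SpecialLinearGroup.SL2_inv_expl g]
  simp

/-- The bottom row of a matrix modulo `q`. -/
def bottomRow (q : ℕ) (g : SL2Z) : PrimPair q :=
  ⟨((g 1 0 : ℤ), (g 1 1 : ℤ)), -((g 0 1 : ℤ) : ZMod q), ((g 0 0 : ℤ) : ZMod q), by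
    linear_combination det_entries_zmod q g⟩

lemma bottomRow_eq_bottomRow_iff (g h : SL2Z) : bottomRow q g = bottomRow q h ↔
    ((g 1 0 : ℤ) : ZMod q) = ((h 1 0 : ℤ) : ZMod q) ∧
      ((g 1 1 : ℤ) : ZMod q) = ((h 1 1 : ℤ) : ZMod q) :=
  Subtype.ext_iff.trans Prod.ext_iff

lemma exists_coprime_lift [NeZero q] {c d : ℕ} (hc : c ≠ 0) (h : (q.gcd c).Coprime d) :
    ∃ k, c.Coprime k ∧ k ≡ d [MOD q] := by
  have : NeZero c := ⟨hc⟩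
  obtain ⟨u, hu⟩ := ZMod.unitsMap_surjective (Nat.gcd_dvd_right q c)
    (ZMod.unitOfCoprime d h.symm)
  have h1 : ((u : ZMod c).val : ZMod (q.gcd c)) = d := by
    have := congrArg Units.val hu
    rwa [ZMod.unitsMap_val, ZMod.coe_unitOfCoprime, ZMod.cast_eq_val] at this
  obtain ⟨k, hk1, hk2⟩ := Nat.chineseRemainder' ((ZMod.natCast_eq_natCast_iff _ _ _).1 h1.symm)
  refine ⟨k, ?_, hk1⟩
  rw [Nat.coprime_iff_gcd_eq_one, Nat.gcd_comm, hk2.gcd_eq]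
  exact ZMod.val_coe_unit_coprime u

lemma surjective_bottomRow [NeZero q] : Function.Surjective (bottomRow q) := by
  rintro ⟨⟨c, d⟩, h⟩
  obtain ⟨k, hk, hkd⟩ := exists_coprime_lift (q := q) (c := c.val + q) (d := d.val)
    (by have := NeZero.pos q; lia)
    (by simpa using (isCoprime_iff_coprime_gcd_val c d).1 h)
  obtain ⟨g, -, hg⟩ := ModularGroup.bottom_row_surj (R := ℤ)
    (a := ![((c.val + q : ℕ) : ℤ), (k : ℤ)]) (by simpa using Nat.isCoprime_iff_coprime.2 hk)
  have h0 : g 1 0 = ((c.val + q : ℕ) : ℤ) := by simpa using congrFun hg 0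
  have h1 : g 1 1 = (k : ℤ) := by simpa using congrFun hg 1
  refine ⟨g, Subtype.ext (Prod.ext ?_ ?_)⟩
  · simp [bottomRow, h0]
  · have := (ZMod.natCast_eq_natCast_iff _ _ _).2 hkd
    simpa [bottomRow, h1] using this

lemma mem_Gamma1_iff (g : SL2Z) :
    g ∈ Gamma1 q ↔ ((g 1 0 : ℤ) : ZMod q) = 0 ∧ ((g 1 1 : ℤ) : ZMod q) = 1 := by
  rw [Gamma1_mem]
  refine ⟨fun h => ⟨h.2.2, h.2.1⟩, fun h => ⟨?_, h.2, h.1⟩⟩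
  have := det_entries_zmod q g
  rw [h.1, h.2] at this
  simpa using this

lemma GammaQN_one (q : ℕ) : GammaQN q 1 = Gamma1 q :=
  inf_eq_left.2 fun _ _ => Subsingleton.elim (α := ZMod 1) _ _

lemma bottomRow_eq_iff (g h : SL2Z) : bottomRow q g = bottomRow q h ↔ g * h⁻¹ ∈ Gamma1 q := by
  obtain ⟨i1, i2, i3, i4⟩ := inv_entries h
  have dh := det_entries_zmod q h
  rw [mem_Gamma1_iff, mul_entry, mul_entry, i1, i2, i3, i4, bottomRow_eq_bottomRow_iff]
  push_cast
  refine ⟨fun ⟨h1, h2⟩ => ⟨?_, ?_⟩, fun ⟨h1, h2⟩ => ⟨?_, ?_⟩⟩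
  · rw [h1, h2]; ring
  · rw [h1, h2]; linear_combination dh
  · linear_combination ((h 0 0 : ℤ) : ZMod q) * h1 + ((h 1 0 : ℤ) : ZMod q) * h2 -
      ((g 1 0 : ℤ) : ZMod q) * dh
  · linear_combination ((h 0 1 : ℤ) : ZMod q) * h1 + ((h 1 1 : ℤ) : ZMod q) * h2 -
      ((g 1 1 : ℤ) : ZMod q) * dh

lemma card_eq_of_surjective {X A B : Type*} {f : X → A} {g : X → B} (hf : Function.Surjective f)
    (hg : Function.Surjective g) (h : ∀ x y, f x = f y ↔ g x = g y) : Nat.card A = Nat.card B :=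
  have hk : Setoid.ker f = Setoid.ker g := Setoid.ext h
  Nat.card_congr <| (Setoid.quotientKerEquivOfSurjective f hf).symm.trans <|
    (Quotient.congrRight fun x y => by rw [hk]).trans (Setoid.quotientKerEquivOfSurjective g hg)

lemma index_Gamma1 [NeZero q] : (Gamma1 q).index = Nat.card (PrimPair q) :=
  card_eq_of_surjective (f := fun g : SL2Z => (QuotientGroup.mk g⁻¹ : SL2Z ⧸ Gamma1 q))
    (QuotientGroup.mk_surjective.comp inv_surjective) surjective_bottomRow fun g h => by
      rw [QuotientGroup.eq, inv_inv, bottomRow_eq_iff]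

lemma mem_pm_iff (Γ : Subgroup SL2Z) (g : SL2Z) : g ∈ pm Γ ↔ g ∈ Γ ∨ -g ∈ Γ := by
  constructor
  · let K : Subgroup SL2Z :=
      { carrier := {g | g ∈ Γ ∨ -g ∈ Γ}
        one_mem' := .inl (one_mem Γ)
        mul_mem' := by
          rintro a b (ha | ha) (hb | hb)
          · exact .inl (mul_mem ha hb)
          · exact .inr (by simpa using mul_mem ha hb)
          · exact .inr (by simpa using mul_mem ha hb)
          · exact .inl (by simpa using mul_mem ha hb)
        inv_mem' := by
          rintro a (ha | ha)
          · exact .inl (inv_mem ha)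
          · exact .inr (by simpa using inv_mem ha) }
    have hK : pm Γ ≤ K := sup_le (fun _ => .inl)
      (Subgroup.zpowers_le.2 (.inr (by rw [neg_neg]; exact one_mem Γ)))
    exact fun hg => hK hg
  · rintro (h | h)
    · exact (le_sup_left : Γ ≤ pm Γ) h
    · have h1 : (-1 : SL2Z) ∈ pm Γ :=
        (le_sup_right : _ ≤ pm Γ) (Subgroup.mem_zpowers (-1 : SL2Z))
      simpa using mul_mem h1 ((le_sup_left : Γ ≤ pm Γ) h)

lemma neg_one_notMem_Gamma1 (hq : 3 ≤ q) : (-1 : SL2Z) ∉ Gamma1 q := by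
  rw [mem_Gamma1_iff]
  rintro ⟨-, h⟩
  refine zmod_natCast_ne_zero (q := q) two_ne_zero hq ?_
  have h' : (-1 : ZMod q) = 1 := by simpa using h
  push_cast
  linear_combination -h'

lemma two_mul_index_pm (hq : 3 ≤ q) : 2 * (pm (Gamma1 q)).index = (Gamma1 q).index := by
  rw [← Subgroup.relIndex_mul_index (le_sup_left : Gamma1 q ≤ pm (Gamma1 q))]
  congr 1
  refine (Subgroup.relIndex_eq_two_iff.2 ⟨-1, ?_, fun b hb => ?_⟩).symm
  · exact (mem_pm_iff _ _).2 (.inr (by simp))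
  · rw [mul_neg_one]
    rcases (mem_pm_iff _ _).1 hb with h | h
    · exact .inr ⟨h, fun h' => neg_one_notMem_Gamma1 hq (by simpa using mul_mem h' (inv_mem h))⟩
    · exact .inl ⟨h, fun h' => neg_one_notMem_Gamma1 hq (by simpa using mul_mem h (inv_mem h'))⟩

lemma moebius_none_of_eq_zero {g : SL2Z} (h : g 1 0 = 0) : moebius g none = none := by
  simp [moebius, h]

lemma moebius_none_of_ne_zero {g : SL2Z} (h : g 1 0 ≠ 0) :
    moebius g none = some ((g 0 0 : ℚ) / (g 1 0 : ℚ)) := by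
  simp [moebius, h]

lemma moebius_moebius_none (g h : SL2Z) : moebius g (moebius h none) = moebius (g * h) none := by
  by_cases h0 : h 1 0 = 0
  · have hd := det_entries h
    rw [h0, mul_zero, sub_zero] at hd
    have h1 : h 0 0 ≠ 0 := left_ne_zero_of_mul_eq_one hd
    have h1' : (h 0 0 : ℚ) ≠ 0 := mod_cast h1
    have e1 : (g * h) 1 0 = g 1 0 * h 0 0 := by rw [mul_entry, h0]; ring
    have e0 : (g * h) 0 0 = g 0 0 * h 0 0 := by rw [mul_entry, h0]; ring
    rw [moebius_none_of_eq_zero h0]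
    by_cases g0 : g 1 0 = 0
    · rw [moebius_none_of_eq_zero g0, moebius_none_of_eq_zero (by rw [e1, g0, zero_mul])]
    · rw [moebius_none_of_ne_zero g0, moebius_none_of_ne_zero (by rw [e1]; exact mul_ne_zero g0 h1),
        e1, e0]
      push_cast
      rw [mul_div_mul_right _ _ h1']
  · have h0' : (h 1 0 : ℚ) ≠ 0 := mod_cast h0
    rw [moebius_none_of_ne_zero h0]
    have e (i : Fin 2) : (g i 0 : ℚ) * ((h 0 0 : ℚ) / (h 1 0 : ℚ)) + (g i 1 : ℚ) =
        (((g * h) i 0 : ℤ) : ℚ) / (h 1 0 : ℚ) := by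
      rw [mul_entry]
      push_cast
      field_simp
    have hm : moebius g (some ((h 0 0 : ℚ) / (h 1 0 : ℚ))) =
        if (((g * h) 1 0 : ℤ) : ℚ) / (h 1 0 : ℚ) = 0 then none
        else some (((((g * h) 0 0 : ℤ) : ℚ) / (h 1 0 : ℚ)) /
          ((((g * h) 1 0 : ℤ) : ℚ) / (h 1 0 : ℚ))) := by
      rw [← e, ← e]
      rfl
    rw [hm, div_div_div_cancel_right₀ h0']
    by_cases k0 : (g * h) 1 0 = 0
    · rw [moebius_none_of_eq_zero k0, if_pos (by simp [k0])]
    · rw [moebius_none_of_ne_zero k0, if_neg (div_ne_zero (mod_cast k0) h0')]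

lemma exists_moebius_none_eq (x : Option ℚ) : ∃ g : SL2Z, moebius g none = x := by
  cases x with
  | none => exact ⟨1, moebius_none_of_eq_zero (by simp)⟩
  | some t =>
    obtain ⟨u, v, huv⟩ : IsCoprime t.num (t.den : ℤ) :=
      Int.isCoprime_iff_gcd_eq_one.2 t.reduced
    obtain ⟨g, h0, h1⟩ : ∃ g : SL2Z, g 0 0 = t.num ∧ g 1 0 = t.den :=
      ⟨⟨!![t.num, -v; t.den, u], by rw [Matrix.det_fin_two_of]; linear_combination huv⟩, rfl, rfl⟩
    refine ⟨g, ?_⟩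
    rw [moebius_none_of_ne_zero (by simp [h1]), h0, h1]
    simp [Rat.num_div_den]

lemma moebius_mul (g h : SL2Z) (x : Option ℚ) :
    moebius (g * h) x = moebius g (moebius h x) := by
  obtain ⟨k, rfl⟩ := exists_moebius_none_eq x
  simp only [moebius_moebius_none, mul_assoc]

lemma moebius_one (x : Option ℚ) : moebius 1 x = x := by
  obtain ⟨k, rfl⟩ := exists_moebius_none_eq x
  rw [moebius_moebius_none, one_mul]

lemma equivalence_cuspRel (Γ : Subgroup SL2Z) : Equivalence (cuspRel Γ) where
  refl x := ⟨1, one_mem _, moebius_one x⟩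
  symm := by
    rintro x _ ⟨γ, hγ, rfl⟩
    exact ⟨γ⁻¹, inv_mem hγ, by rw [← moebius_mul, inv_mul_cancel, moebius_one]⟩
  trans := by
    rintro x _ _ ⟨γ, hγ, rfl⟩ ⟨δ, hδ, rfl⟩
    exact ⟨δ * γ, mul_mem hδ hγ, moebius_mul _ _ _⟩

/-- The element `± [1, n; 0, 1]` of the stabilizer of `∞`. -/
def signedShift (u : ℤˣ) (n : ℤ) : SL2Z :=
  ⟨!![(u : ℤ), u * n; 0, (u : ℤ)], by
    rw [Matrix.det_fin_two_of, mul_zero, sub_zero, ← Units.val_mul, Int.units_mul_self,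
      Units.val_one]⟩

lemma signedShift_entries (u : ℤˣ) (n : ℤ) :
    signedShift u n 0 0 = u ∧ signedShift u n 0 1 = u * n ∧
      signedShift u n 1 0 = 0 ∧ signedShift u n 1 1 = u :=
  ⟨rfl, rfl, rfl, rfl⟩

lemma moebius_none_eq_none_iff (g : SL2Z) :
    moebius g none = none ↔ ∃ u n, g = signedShift u n := by
  constructor
  · intro h
    have h0 : g 1 0 = 0 := by
      by_contra h0
      simp [moebius_none_of_ne_zero h0] at h
    have hd := det_entries g
    rw [h0, mul_zero, sub_zero] at hd
    obtain ⟨u, hu⟩ := IsUnit.of_mul_eq_one _ hd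
    have hu' : (u : ℤ) * u = 1 := by rw [← Units.val_mul, Int.units_mul_self, Units.val_one]
    refine ⟨u, u * g 0 1, ?_⟩
    ext i j
    fin_cases i <;> fin_cases j
    · simp [signedShift, hu]
    · simp only [signedShift, ← mul_assoc, hu']; simp
    · simpa [signedShift] using h0
    · simp only [← hu] at hd
      simp only [signedShift]
      simp
      linear_combination u * hd - g 1 1 * hu'
  · rintro ⟨u, n, rfl⟩
    exact moebius_none_of_eq_zero (by simp [signedShift])

lemma bottomRow_mul_signedShift (g : SL2Z) (u : ℤˣ) (n : ℤ) :
    bottomRow q (g * signedShift u n) =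
      ((u, .ofAdd (n : ZMod q)) : ShearGroup q) • bottomRow q g := by
  obtain ⟨s0, s1, s2, s3⟩ := signedShift_entries u n
  refine ((shear_smul_eq_iff _ _ _).2 ⟨?_, ?_⟩).symm
  · simp only [bottomRow, mul_entry, s0, s2]
    push_cast
    ring
  · simp only [bottomRow, mul_entry, s1, s3]
    push_cast
    rw [toAdd_ofAdd]
    ring

lemma cuspRel_Gamma1_iff [NeZero q] (g h : SL2Z) :
    cuspRel (Gamma1 q) (moebius g none) (moebius h none) ↔
      ∃ s : ShearGroup q, s • bottomRow q g = bottomRow q h := by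
  constructor
  · rintro ⟨γ, hγ, e⟩
    rw [moebius_moebius_none] at e
    have e' : moebius ((γ * g)⁻¹ * h) none = none := by
      rw [moebius_mul, ← e, ← moebius_mul, inv_mul_cancel, moebius_one]
    obtain ⟨u, n, hk⟩ := (moebius_none_eq_none_iff _).1 e'
    have hγg : bottomRow q (γ * g) = bottomRow q g :=
      (bottomRow_eq_iff _ _).2 (by simpa using hγ)
    exact ⟨_, by rw [← hγg, ← bottomRow_mul_signedShift _ u n, ← hk, mul_inv_cancel_left]⟩
  · rintro ⟨⟨u, j⟩, e⟩
    obtain ⟨n, hn⟩ := ZMod.intCast_surjective j.toAdd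
    have hj : j = .ofAdd (n : ZMod q) := by rw [hn]; rfl
    rw [hj, ← bottomRow_mul_signedShift, eq_comm, bottomRow_eq_iff] at e
    refine ⟨_, e, ?_⟩
    have hk : moebius (signedShift u n) none = none :=
      (moebius_none_eq_none_iff _).2 ⟨u, n, rfl⟩
    have hg : moebius (g * signedShift u n) none = moebius g none := by rw [moebius_mul, hk]
    rw [← hg, moebius_moebius_none, inv_mul_cancel_right]

lemma numCusps_Gamma1 [NeZero q] : numCusps (Gamma1 q) =
    Nat.card (MulAction.orbitRel.Quotient (ShearGroup q) (PrimPair q)) := by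
  refine card_eq_of_surjective
    (f := fun g : SL2Z => Quot.mk (cuspRel (Gamma1 q)) (moebius g none))
    (g := fun g : SL2Z => Quotient.mk (MulAction.orbitRel (ShearGroup q) (PrimPair q))
      (bottomRow q g)) ?_ (Quotient.mk_surjective.comp surjective_bottomRow) fun g h => ?_
  · rintro ⟨x⟩
    obtain ⟨g, rfl⟩ := exists_moebius_none_eq x
    exact ⟨g, rfl⟩
  · rw [Quot.eq, (equivalence_cuspRel _).eqvGen_iff, cuspRel_Gamma1_iff, eq_comm, Quotient.eq]
    rfl

end ModularGroup

theorem stmt10 (q : ℕ) (hq : 5 ≤ q) :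
    (1 - (numCusps (GammaQN q 1) : ℚ) / 2 + ((pm (GammaQN q 1)).index : ℚ) / 12 = 0 ↔
      (q ≤ 10 ∨ q = 12)) ∧
    ((q : ℚ) - 6 * calN q < 0 ↔ (q ≤ 10 ∨ q = 12)) := by
  refine ⟨?_, sub_six_mul_calN_neg_iff hq⟩
  have : NeZero q := ⟨by lia⟩
  have h1 : (2 : ℚ) * numCusps (Gamma1 q) = orbitFun q := by
    rw [numCusps_Gamma1]
    exact_mod_cast two_mul_card_orbits hq
  have h2 : (2 : ℚ) * (pm (Gamma1 q)).index = pairFun q := by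
    rw [← card_primPair, ← index_Gamma1, ← two_mul_index_pm (by lia)]
    push_cast
    rfl
  rw [GammaQN_one, ← orbitFun_eq_iff hq, ← h1, ← h2]
  constructor <;> intro h <;> linarith
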